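/- Let n ≥ 1 and let 1 ≤ j < i ≤ n. Then the number of subsets S ⊆ {1,…,n} such that π_S(i) = j equals 2^{j−1}·binom(n−j, i−j). Consequently, under the Gilbert–Shannon–Reeds one-time riffle shuffle (in which each pair of a cut position and an interleaving, i.e. each subset S, occurs with probability 1/2^n), the probability that the card labeled i ends up at position j is binom(n−j, i−j)/2^{n−j+1}. -/

import Mathlib

/-- The riffle-shuffle permutation determined by a subset `S` of the positions (0-indexed):
a label `i` with `i < |S|` is sent to the `(i+1)`-st smallest element of `S`, and a label `i`
with `|S| ≤ i` is sent to the `(i - |S| + 1)`-st smallest element of the complement of `S`. -/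
noncomputable def riffle {n : ℕ} (S : Finset (Fin n)) (i : Fin n) : Fin n :=
  if h : (i : ℕ) < S.card then
    S.orderEmbOfFin rfl ⟨(i : ℕ), h⟩
  else
    Sᶜ.orderEmbOfFin (by rw [Finset.card_compl, Fintype.card_fin])
      ⟨(i : ℕ) - S.card, by
        have hi := i.isLt
        have hc : S.card ≤ n := S.card_le_univ.trans_eq (by simp)
        omega⟩

/-- The `k`-th smallest element of `T` is the element of `T` with exactly `k` elements below it. -/
theorem orderEmbOfFin_eq_iff {α : Type*} [LinearOrder α] (T : Finset α) {m : ℕ}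
    (h : T.card = m) (k : Fin m) (x : α) :
    T.orderEmbOfFin h k = x ↔ x ∈ T ∧ (T.filter (· < x)).card = (k : ℕ) := by
  have card_below (l : Fin m) :
      (T.filter (· < T.orderEmbOfFin h l)).card = (l : ℕ) := by
    have : T.filter (· < T.orderEmbOfFin h l)
        = (Finset.Iio l).map (T.orderEmbOfFin h).toEmbedding := by
      ext y
      simp only [Finset.mem_filter, Finset.mem_map, Finset.mem_Iio]
      constructor
      · rintro ⟨hy, hlt⟩
        rw [← Finset.mem_coe, ← Finset.range_orderEmbOfFin T h] at hy
        obtain ⟨p, rfl⟩ := hy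
        exact ⟨p, by simpa using hlt, rfl⟩
      · rintro ⟨p, hp, rfl⟩
        exact ⟨Finset.orderEmbOfFin_mem T h p, by simpa using hp⟩
    rw [this, Finset.card_map, Fin.card_Iio]
  constructor
  · rintro rfl
    exact ⟨Finset.orderEmbOfFin_mem T h k, card_below k⟩
  · rintro ⟨hx, hc⟩
    rw [← Finset.mem_coe, ← Finset.range_orderEmbOfFin T h] at hx
    obtain ⟨p, rfl⟩ := hx
    rw [card_below] at hc
    rw [Fin.ext hc]

/-- A card that moves up to position `b` comes from the lower packet and passes exactly `a - b`
cards of the upper packet, which end up below it. -/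
theorem riffle_eq_iff_of_lt {n : ℕ} (S : Finset (Fin n)) {a b : Fin n} (hba : b < a) :
    riffle S a = b ↔ b ∉ S ∧ (S.filter (b < ·)).card = (a : ℕ) - b := by
  have below : (S.filter (· < b)).card + (Sᶜ.filter (· < b)).card = (b : ℕ) := by
    rw [← Fin.card_Iio b, ← Finset.card_union_of_disjoint]
    · congr 1
      ext x
      simp only [Finset.mem_union, Finset.mem_filter, Finset.mem_compl, Finset.mem_Iio]
      tauto
    · exact Finset.disjoint_filter_filter disjoint_compl_right
  have split (hb : b ∉ S) : (S.filter (· < b)).card + (S.filter (b < ·)).card = S.card := by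
    rw [← Finset.card_filter_add_card_filter_not (s := S) (· < b)]
    congr 2
    refine Finset.filter_congr fun x hx => ?_
    have : x ≠ b := fun h => hb (h ▸ hx)
    rw [not_lt]
    exact ⟨le_of_lt, fun h => lt_of_le_of_ne h this.symm⟩
  have hlt : (b : ℕ) < a := hba
  unfold riffle
  split_ifs with h
  · rw [orderEmbOfFin_eq_iff]
    constructor
    · rintro ⟨-, hc⟩
      simp only at hc
      omega
    · rintro ⟨hb, hc⟩
      have := split hb
      omega
  · rw [orderEmbOfFin_eq_iff, Finset.mem_compl]
    refine and_congr_right fun hb => ?_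
    have := split hb
    simp only
    omega

/-- The number of sets omitting `b` and having exactly `k` elements above `b`. -/
theorem card_filter_notMem_card_above {n : ℕ} (b : Fin n) (k : ℕ) :
    (Finset.univ.filter (fun S : Finset (Fin n) =>
      b ∉ S ∧ (S.filter (b < ·)).card = k)).card = 2 ^ (b : ℕ) * (n - 1 - b).choose k := by
  rw [← Fin.card_Ioi b, ← Finset.card_powersetCard]
  rw [← Fin.card_Iio b, ← Finset.card_powerset,
    ← Finset.card_product]
  refine Finset.card_bij' (fun S _ => (S.filter (· < b), S.filter (b < ·)))
    (fun p _ => p.1 ∪ p.2) ?_ ?_ ?_ ?_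
  · intro S hS
    simp only [Finset.mem_filter, Finset.mem_univ, true_and] at hS
    simp only [Finset.mem_product, Finset.mem_powerset, Finset.mem_powersetCard]
    refine ⟨fun x hx => ?_, fun x hx => ?_, hS.2⟩ <;> simp_all
  · rintro ⟨A, B⟩ hp
    simp only [Finset.mem_product, Finset.mem_powerset, Finset.mem_powersetCard] at hp
    obtain ⟨hA, hB, hk⟩ := hp
    have : (A ∪ B).filter (b < ·) = B := by grind
    simp only [Finset.mem_filter, Finset.mem_univ, true_and, this]
    grind
  · intro S hS
    ext x
    grind
  · rintro ⟨A, B⟩ hp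
    simp only [Finset.mem_product, Finset.mem_powerset, Finset.mem_powersetCard] at hp
    obtain ⟨hA, hB, hk⟩ := hp
    refine Prod.ext ?_ ?_ <;> grind

theorem stmt18 (n i j : ℕ) (hn : 1 ≤ n) (hj : 1 ≤ j) (hji : j < i) (hin : i ≤ n) :
    (Finset.univ.filter (fun S : Finset (Fin n) =>
        riffle S ⟨i - 1, by omega⟩ = ⟨j - 1, by omega⟩)).card
      = 2 ^ (j - 1) * (n - j).choose (i - j) ∧
    ((Finset.univ.filter (fun S : Finset (Fin n) =>
        riffle S ⟨i - 1, by omega⟩ = ⟨j - 1, by omega⟩)).card : ℝ) / 2 ^ n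
      = ((n - j).choose (i - j) : ℝ) / 2 ^ (n - j + 1) := by
  have count : (Finset.univ.filter (fun S : Finset (Fin n) =>
        riffle S ⟨i - 1, by omega⟩ = ⟨j - 1, by omega⟩)).card
      = 2 ^ (j - 1) * (n - j).choose (i - j) := by
    have hlt : (⟨j - 1, by omega⟩ : Fin n) < ⟨i - 1, by omega⟩ := by
      rw [Fin.mk_lt_mk]
      omega
    simp only [riffle_eq_iff_of_lt _ hlt]
    rw [card_filter_notMem_card_above]
    have hsub : n - 1 - (j - 1) = n - j := by omega
    have hdiff : i - 1 - (j - 1) = i - j := by omega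
    rw [hsub, hdiff]
  refine ⟨count, ?_⟩
  have hpow : (2 : ℝ) ^ n = 2 ^ (j - 1) * 2 ^ (n - j + 1) := by
    rw [← pow_add]
    congr 1
    omega
  rw [count, hpow]
  push_cast
  exact mul_div_mul_left _ _ (by positivity)
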